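/- arXiv:1704.00040 — 5 statements merged into one kernel-verified Lean document; each statement's English description precedes it below -/
import Mathlib

section
/- Let n ≥ 1 be an integer and ν > 2 a real number, and let p(r) = 2 r^{n+1} (1+r²)^{-(ν+n)/2} / B((n+2)/2, (ν-2)/2) for r > 0. Then ∫₀^∞ (1 - n/((ν-2) r²)) p(r) dr = 0; equivalently, ∫₀^∞ p(r) dr = 1 and ∫₀^∞ (n/((ν-2) r²)) p(r) dr = 1. -/
open Real MeasureTheory Set

/-- The real Beta function: `B(a,b) = Γ(a)Γ(b)/Γ(a+b)`. -/
noncomputable def Beta (a b : ℝ) : ℝ := Real.Gamma a * Real.Gamma b / Real.Gamma (a + b)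

/-- The radial sampling density `p(r) = 2 r^(n+1) (1+r²)^(-(ν+n)/2) / B((n+2)/2, (ν-2)/2)`. -/
noncomputable def radialPDF (n : ℕ) (ν : ℝ) (r : ℝ) : ℝ :=
  2 * r ^ (n + 1) * (1 + r ^ 2) ^ (-((ν + n) / 2)) / Beta (((n : ℝ) + 2) / 2) ((ν - 2) / 2)

/-- The real Beta function as an integral over `(0,1)`. -/
theorem integral_Ioo_rpow_mul_one_sub_rpow {a b : ℝ} (ha : 0 < a) (hb : 0 < b) :
    ∫ x in Ioo (0 : ℝ) 1, x ^ (a - 1) * (1 - x) ^ (b - 1) = Beta a b := by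
  have h := ProbabilityTheory.beta_eq_betaIntegralReal a b ha hb
  have h2 : (∫ x in (0 : ℝ)..1, x ^ (a - 1) * (1 - x) ^ (b - 1)) =
      (Complex.betaIntegral a b).re := by
    have : Complex.betaIntegral a b =
        ((∫ x in (0 : ℝ)..1, x ^ (a - 1) * (1 - x) ^ (b - 1) : ℝ) : ℂ) := by
      rw [Complex.betaIntegral, ← intervalIntegral.integral_ofReal]
      refine intervalIntegral.integral_congr fun x hx => ?_
      rw [uIcc_of_le zero_le_one] at hx
      have h1x : 0 ≤ 1 - x := by linarith [hx.2]
      simp only [Complex.ofReal_mul, Complex.ofReal_cpow hx.1, Complex.ofReal_cpow h1x]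
      push_cast
      rfl
    rw [this, Complex.ofReal_re]
  rw [← integral_Ioc_eq_integral_Ioo, ← intervalIntegral.integral_of_le zero_le_one, h2, ← h]
  rfl

/-- The map `r ↦ r² / (1 + r²)` sends `(0,∞)` onto `(0,1)`. -/
theorem image_sq_div_one_add_sq_Ioi :
    (fun r : ℝ => r ^ 2 / (1 + r ^ 2)) '' Ioi 0 = Ioo 0 1 := by
  ext x
  constructor
  · rintro ⟨r, hr, rfl⟩
    have hr : 0 < r := hr
    exact ⟨by positivity, by rw [div_lt_one (by positivity)]; linarith⟩
  · rintro ⟨h0, h1⟩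
    have h1 : 0 < 1 - x := by linarith
    refine ⟨√(x / (1 - x)), Real.sqrt_pos.2 (by positivity), ?_⟩
    simp only [Real.sq_sqrt (show 0 ≤ x / (1 - x) by positivity)]
    field_simp
    ring

theorem injOn_sq_div_one_add_sq :
    InjOn (fun r : ℝ => r ^ 2 / (1 + r ^ 2)) (Ioi 0) := by
  intro r hr s hs h
  have hr : 0 < r := hr
  have hs : 0 < s := hs
  simp only at h
  rw [div_eq_div_iff (by positivity) (by positivity)] at h
  exact (sq_eq_sq₀ hr.le hs.le).1 (by linarith)

/-- The Beta function as a radial integral over `(0,∞)`. -/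
theorem integral_Ioi_rpow_mul_one_add_sq_rpow {a b : ℝ} (ha : 0 < a) (hb : 0 < b) :
    ∫ r in Ioi (0 : ℝ), 2 * r ^ (2 * a - 1) * (1 + r ^ 2) ^ (-(a + b)) = Beta a b := by
  have hd : ∀ r ∈ Ioi (0 : ℝ), HasDerivWithinAt (fun r : ℝ => r ^ 2 / (1 + r ^ 2))
      (2 * r / (1 + r ^ 2) ^ 2) (Ioi 0) r := by
    intro r _
    have h := (hasDerivAt_pow 2 r).div ((hasDerivAt_pow 2 r).const_add 1)
      (by positivity : 1 + r ^ 2 ≠ 0)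
    refine (h.congr_deriv ?_).hasDerivWithinAt
    simp
    ring
  rw [← integral_Ioo_rpow_mul_one_sub_rpow ha hb, ← image_sq_div_one_add_sq_Ioi,
    integral_image_eq_integral_abs_deriv_smul measurableSet_Ioi hd injOn_sq_div_one_add_sq]
  refine setIntegral_congr_fun measurableSet_Ioi fun r hr => ?_
  have hr : 0 < r := hr
  have hs : 0 < 1 + r ^ 2 := by positivity
  have h1 : 1 - r ^ 2 / (1 + r ^ 2) = (1 + r ^ 2)⁻¹ := by field_simp; ring
  have hpow : r ^ (2 * a - 1) = (r ^ 2) ^ (a - 1) * r := by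
    rw [← Real.rpow_natCast r 2, ← Real.rpow_mul hr.le, ← Real.rpow_add_one hr.ne']
    push_cast
    ring_nf
  have hq : (1 + r ^ 2) ^ (-(a + b)) =
      ((1 + r ^ 2) ^ (a - 1))⁻¹ * ((1 + r ^ 2) ^ (b - 1))⁻¹ * ((1 + r ^ 2) ^ 2)⁻¹ := by
    rw [← Real.rpow_natCast (1 + r ^ 2) 2, ← Real.rpow_neg hs.le, ← Real.rpow_neg hs.le,
      ← Real.rpow_neg hs.le, ← Real.rpow_add hs, ← Real.rpow_add hs]
    push_cast
    ring_nf
  simp only [smul_eq_mul]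
  rw [abs_of_pos (by positivity), h1, Real.div_rpow (by positivity) hs.le, Real.inv_rpow hs.le,
    hpow, hq]
  ring

theorem Beta_pos {a b : ℝ} (ha : 0 < a) (hb : 0 < b) : 0 < Beta a b :=
  div_pos (mul_pos (Real.Gamma_pos_of_pos ha) (Real.Gamma_pos_of_pos hb))
    (Real.Gamma_pos_of_pos (add_pos ha hb))

theorem mul_Beta_add_one_left {a b : ℝ} (ha : a ≠ 0) (hb : b ≠ 0) :
    b * Beta (a + 1) b = a * Beta a (b + 1) := by
  simp only [Beta, Real.Gamma_add_one ha, Real.Gamma_add_one hb]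
  rw [add_right_comm, add_assoc a b 1]
  ring_nf

theorem integral_radialPDF (n : ℕ) {ν : ℝ} (hν : 2 < ν) :
    ∫ r in Ioi (0 : ℝ), radialPDF n ν r = 1 := by
  have ha : 0 < ((n : ℝ) + 2) / 2 := by positivity
  have hb : 0 < (ν - 2) / 2 := by linarith
  simp only [radialPDF]
  rw [integral_div, div_eq_one_iff_eq (Beta_pos ha hb).ne',
    ← integral_Ioi_rpow_mul_one_add_sq_rpow ha hb]
  refine setIntegral_congr_fun measurableSet_Ioi fun r _ => ?_
  simp only [← Real.rpow_natCast r (n + 1)]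
  push_cast
  ring_nf

theorem integral_div_sq_mul_radialPDF {n : ℕ} (hn : 1 ≤ n) {ν : ℝ} (hν : 2 < ν) :
    ∫ r in Ioi (0 : ℝ), (n / ((ν - 2) * r ^ 2)) * radialPDF n ν r = 1 := by
  have hn0 : (0 : ℝ) < n := by exact_mod_cast hn
  have hν0 : 0 < ν - 2 := by linarith
  have ha : 0 < (n : ℝ) / 2 := by positivity
  have hb : 0 < (ν - 2) / 2 := by positivity
  have hB := Beta_pos (add_pos ha one_pos) hb
  have hrec := mul_Beta_add_one_left ha.ne' hb.ne'
  have hint := integral_Ioi_rpow_mul_one_add_sq_rpow ha (add_pos hb one_pos)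
  have hshift : ((n : ℝ) + 2) / 2 = n / 2 + 1 := by ring
  have key : ∀ r ∈ Ioi (0 : ℝ), (n / ((ν - 2) * r ^ 2)) * radialPDF n ν r =
      n / ((ν - 2) * Beta (n / 2 + 1) ((ν - 2) / 2)) *
        (2 * r ^ (2 * ((n : ℝ) / 2) - 1) * (1 + r ^ 2) ^ (-((n : ℝ) / 2 + ((ν - 2) / 2 + 1)))) := by
    intro r hr
    have hr : 0 < r := hr
    have hp : r ^ (n + 1) = r ^ (2 * ((n : ℝ) / 2) - 1) * r ^ 2 := by
      rw [← Real.rpow_natCast r (n + 1), ← Real.rpow_natCast r 2, ← Real.rpow_add hr]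
      push_cast
      ring_nf
    have he : -((n : ℝ) / 2 + ((ν - 2) / 2 + 1)) = -((ν + n) / 2) := by ring
    rw [radialPDF, hp, he, hshift]
    field_simp
  rw [setIntegral_congr_fun measurableSet_Ioi key, integral_const_mul, hint,
    div_mul_eq_mul_div, div_eq_one_iff_eq (by positivity)]
  linarith

/-- For an integer `n ≥ 1` and a real `ν > 2`: `∫₀^∞ (1 - n/((ν-2) r²)) p(r) dr = 0`;
equivalently `∫₀^∞ p(r) dr = 1` and `∫₀^∞ (n/((ν-2) r²)) p(r) dr = 1`. -/
theorem radial_weight_expectation_zero (n : ℕ) (hn : 1 ≤ n) (ν : ℝ) (hν : 2 < ν) :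
    (∫ r in Ioi (0 : ℝ), (1 - n / ((ν - 2) * r ^ 2)) * radialPDF n ν r) = 0 ∧
    (∫ r in Ioi (0 : ℝ), radialPDF n ν r) = 1 ∧
    (∫ r in Ioi (0 : ℝ), (n / ((ν - 2) * r ^ 2)) * radialPDF n ν r) = 1 := by
  have h1 := integral_radialPDF n hν
  have h2 := integral_div_sq_mul_radialPDF hn hν
  refine ⟨?_, h1, h2⟩
  simp only [sub_mul (1 : ℝ), one_mul]
  rw [integral_sub (Integrable.of_integral_ne_zero (by rw [h1]; exact one_ne_zero))
    (Integrable.of_integral_ne_zero (by rw [h2]; exact one_ne_zero)), h1, h2, sub_self]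
end

section
/- (Unbiasedness of the third-degree radial rule, Theorem 1.) Let n ≥ 1 be an integer, ν > 2 a real number, p(r) = 2 r^{n+1} (1+r²)^{-(ν+n)/2} / B((n+2)/2, (ν-2)/2) for r > 0, and let S : [0,∞) → ℝ be a measurable function such that r ↦ S(r) r^{n-1} (1+r²)^{-(ν+n)/2} is integrable on (0,∞). Define the random weights ω₁(r) = (1/2) B(n/2, ν/2) (1 - n/((ν-2) r²)) and ω₂(r) = (1/2) B(n/2, ν/2) · n/((ν-2) r²). Then ∫₀^∞ [ω₁(r) S(0) + ω₂(r) S(r)] p(r) dr = ∫₀^∞ S(r) r^{n-1} (1+r²)^{-(ν+n)/2} dr. -/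
open Real MeasureTheory Set

/-- The random weight `ω₁(r) = (1/2) B(n/2, ν/2) (1 - n/((ν-2) r²))`. -/
noncomputable def ω₁ (n : ℕ) (ν r : ℝ) : ℝ :=
  (1 / 2) * Beta ((n : ℝ) / 2) (ν / 2) * (1 - n / ((ν - 2) * r ^ 2))

/-- The random weight `ω₂(r) = (1/2) B(n/2, ν/2) · n/((ν-2) r²)`. -/
noncomputable def ω₂ (n : ℕ) (ν r : ℝ) : ℝ :=
  (1 / 2) * Beta ((n : ℝ) / 2) (ν / 2) * (n / ((ν - 2) * r ^ 2))

theorem half_beta_ratio {a b : ℝ} (ha : 0 < a) (hb : 2 < b) :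
    Beta (a / 2) (b / 2) * a = (b - 2) * Beta ((a + 2) / 2) ((b - 2) / 2) := by
  have h1 : Real.Gamma ((a + 2) / 2) = a / 2 * Real.Gamma (a / 2) := by
    rw [← Real.Gamma_add_one (by positivity)]; ring_nf
  have h2 : Real.Gamma (b / 2) = (b - 2) / 2 * Real.Gamma ((b - 2) / 2) := by
    rw [← Real.Gamma_add_one (by linarith)]; ring_nf
  have h3 : (a + 2) / 2 + (b - 2) / 2 = a / 2 + b / 2 := by ring
  unfold Beta
  rw [h1, h2, h3]
  ring

theorem pow_le_one_add_sq_rpow {r : ℝ} (hr : 0 ≤ r) {k : ℕ} {s : ℝ} (hks : (k : ℝ) ≤ s) :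
    r ^ k ≤ (1 + r ^ 2) ^ (s / 2) := by
  have h : r ≤ (1 + r ^ 2) ^ (1 / 2 : ℝ) := by
    rw [← Real.sqrt_eq_rpow]
    exact Real.le_sqrt_of_sq_le (by linarith)
  calc r ^ k ≤ ((1 + r ^ 2) ^ (1 / 2 : ℝ)) ^ k := pow_le_pow_left₀ hr h k
    _ = (1 + r ^ 2) ^ ((k : ℝ) / 2) := by
      rw [← Real.rpow_natCast, ← Real.rpow_mul (by positivity)]; ring_nf
    _ ≤ (1 + r ^ 2) ^ (s / 2) :=
      Real.rpow_le_rpow_of_exponent_le (by nlinarith [sq_nonneg r]) (by linarith)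

theorem pow_mul_one_add_sq_rpow_le {r : ℝ} (hr : 0 ≤ r) {k : ℕ} {s t : ℝ}
    (hks : (k : ℝ) ≤ s) :
    r ^ k * (1 + r ^ 2) ^ t ≤ (1 + r ^ 2) ^ (s / 2 + t) := by
  rw [Real.rpow_add (by positivity)]
  gcongr
  exact pow_le_one_add_sq_rpow hr hks

theorem integrableOn_pow_mul_one_add_sq_rpow {k : ℕ} {s : ℝ} (hs : (k : ℝ) + 1 < s) :
    IntegrableOn (fun r : ℝ => r ^ k * (1 + r ^ 2) ^ (-(s / 2))) (Ioi 0) := by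
  have hg : Integrable (fun r : ℝ => (1 + ‖r‖ ^ 2) ^ (-(s - k) / 2)) :=
    integrable_rpow_neg_one_add_norm_sq (by simp; linarith)
  refine hg.integrableOn.mono' ?_ ?_
  · have h : Continuous (fun r : ℝ => r ^ k * (1 + r ^ 2) ^ (-(s / 2))) :=
      (continuous_pow k).mul
        (Continuous.rpow_const (by fun_prop) fun r => Or.inl (by positivity))
    exact h.aestronglyMeasurable
  · filter_upwards [ae_restrict_mem measurableSet_Ioi] with r hr
    have hr : 0 < r := hr
    rw [Real.norm_of_nonneg (by positivity), Real.norm_of_nonneg hr.le]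
    convert pow_mul_one_add_sq_rpow_le hr.le (le_refl (k : ℝ)) using 2
    ring

theorem hasDerivAt_pow_mul_one_add_sq_rpow (m : ℕ) (ν r : ℝ) :
    HasDerivAt (fun r : ℝ => r ^ (m + 1) * (1 + r ^ 2) ^ (1 - (ν + (m + 1)) / 2))
      ((m + 1) * (r ^ m * (1 + r ^ 2) ^ (-((ν + (m + 1)) / 2)))
        - (ν - 2) * (r ^ (m + 2) * (1 + r ^ 2) ^ (-((ν + (m + 1)) / 2)))) r := by
  have hpos : 0 < 1 + r ^ 2 := by positivity
  have h1 : HasDerivAt (fun r : ℝ => 1 + r ^ 2) (2 * r) r := by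
    simpa using (hasDerivAt_pow 2 r).const_add 1
  have h2 := (hasDerivAt_pow (m + 1) r).mul
    (h1.rpow_const (p := 1 - (ν + (m + 1)) / 2) (Or.inl hpos.ne'))
  refine h2.congr_deriv ?_
  have e1 : (1 + r ^ 2) ^ (1 - (ν + (m + 1)) / 2)
      = (1 + r ^ 2) * (1 + r ^ 2) ^ (-((ν + (m + 1)) / 2)) := by
    rw [sub_eq_add_neg, Real.rpow_add hpos, Real.rpow_one]
  have e2 : 1 - (ν + (m + 1)) / 2 - 1 = -((ν + (m + 1)) / 2) := by ring
  rw [e1, e2]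
  push_cast
  ring

theorem tendsto_pow_mul_one_add_sq_rpow {k : ℕ} {t : ℝ} (h : (k : ℝ) / 2 + t < 0) :
    Filter.Tendsto (fun r : ℝ => r ^ k * (1 + r ^ 2) ^ t) Filter.atTop (nhds 0) := by
  have h1 : Filter.Tendsto (fun r : ℝ => 1 + r ^ 2) Filter.atTop Filter.atTop :=
    Filter.tendsto_atTop_add_const_left _ _ (Filter.tendsto_pow_atTop two_ne_zero)
  have h2 := (tendsto_rpow_neg_atTop (y := -((k : ℝ) / 2 + t)) (by linarith)).comp h1
  refine squeeze_zero' ?_ ?_ h2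
  · filter_upwards [Filter.eventually_ge_atTop 0] with r hr
    positivity
  · filter_upwards [Filter.eventually_ge_atTop 0] with r hr
    simpa using pow_mul_one_add_sq_rpow_le hr (le_refl (k : ℝ)) (t := t)

theorem integrableOn_radial_moment_diff (m : ℕ) {ν : ℝ} (hν : 2 < ν) :
    IntegrableOn (fun r : ℝ => (m + 1) * (r ^ m * (1 + r ^ 2) ^ (-((ν + (m + 1)) / 2)))
      - (ν - 2) * (r ^ (m + 2) * (1 + r ^ 2) ^ (-((ν + (m + 1)) / 2)))) (Ioi 0) :=
  ((integrableOn_pow_mul_one_add_sq_rpow (by linarith)).const_mul _).sub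
    ((integrableOn_pow_mul_one_add_sq_rpow (by push_cast; linarith)).const_mul _)

theorem integral_radial_moment_diff (m : ℕ) {ν : ℝ} (hν : 2 < ν) :
    ∫ r in Ioi (0 : ℝ), ((m + 1) * (r ^ m * (1 + r ^ 2) ^ (-((ν + (m + 1)) / 2)))
      - (ν - 2) * (r ^ (m + 2) * (1 + r ^ 2) ^ (-((ν + (m + 1)) / 2)))) = 0 := by
  rw [integral_Ioi_of_hasDerivAt_of_tendsto'
    (fun r _ => hasDerivAt_pow_mul_one_add_sq_rpow m ν r)
    (integrableOn_radial_moment_diff m hν)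
    (tendsto_pow_mul_one_add_sq_rpow (by push_cast; linarith))]
  simp

/-- Unbiasedness of the third-degree radial rule (Theorem 1):
`∫₀^∞ [ω₁(r) S(0) + ω₂(r) S(r)] p(r) dr = ∫₀^∞ S(r) r^(n-1) (1+r²)^(-(ν+n)/2) dr`. -/
theorem radial_rule_unbiased (n : ℕ) (hn : 1 ≤ n) (ν : ℝ) (hν : 2 < ν)
    (S : ℝ → ℝ) (hSm : Measurable S)
    (hSint : IntegrableOn
      (fun r : ℝ => S r * r ^ ((n : ℝ) - 1) * (1 + r ^ 2) ^ (-((ν + n) / 2))) (Ioi 0)) :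
    ∫ r in Ioi (0 : ℝ), (ω₁ n ν r * S 0 + ω₂ n ν r * S r) * radialPDF n ν r =
      ∫ r in Ioi (0 : ℝ), S r * r ^ ((n : ℝ) - 1) * (1 + r ^ 2) ^ (-((ν + n) / 2)) := by
  obtain ⟨m, rfl⟩ : ∃ m, n = m + 1 := ⟨n - 1, by omega⟩
  have hν2 : 0 < ν - 2 := by linarith
  have hB' : 0 < Beta ((((m + 1 : ℕ) : ℝ) + 2) / 2) ((ν - 2) / 2) := by
    unfold Beta
    exact div_pos (mul_pos (Real.Gamma_pos_of_pos (by positivity))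
      (Real.Gamma_pos_of_pos (by positivity))) (Real.Gamma_pos_of_pos (by positivity))
  have hB := half_beta_ratio (a := ((m + 1 : ℕ) : ℝ)) (by positivity) hν
  set B := Beta (((m + 1 : ℕ) : ℝ) / 2) (ν / 2) with hBdef
  set B' := Beta ((((m + 1 : ℕ) : ℝ) + 2) / 2) ((ν - 2) / 2) with hBdef'
  have hpt : ∀ r ∈ Ioi (0 : ℝ),
      (ω₁ (m + 1) ν r * S 0 + ω₂ (m + 1) ν r * S r) * radialPDF (m + 1) ν r =
      -(S 0 * B / (B' * (ν - 2))) *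
        ((m + 1) * (r ^ m * (1 + r ^ 2) ^ (-((ν + (m + 1)) / 2)))
          - (ν - 2) * (r ^ (m + 2) * (1 + r ^ 2) ^ (-((ν + (m + 1)) / 2))))
      + S r * r ^ (((m + 1 : ℕ) : ℝ) - 1) * (1 + r ^ 2) ^ (-((ν + (m + 1 : ℕ)) / 2)) := by
    intro r hr
    have hr : 0 < r := hr
    have hp : r ^ (((m + 1 : ℕ) : ℝ) - 1) = r ^ m := by
      rw [← Real.rpow_natCast]; push_cast; ring_nf
    unfold ω₁ ω₂ radialPDF
    rw [hp, ← hBdef, ← hBdef']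
    push_cast at hB ⊢
    generalize (1 + r ^ 2) ^ (-((ν + ((m : ℝ) + 1)) / 2)) = w
    have hB2 : B = (ν - 2) * B' / (m + 1) := by field_simp; linarith
    rw [hB2]
    field_simp
    ring
  rw [setIntegral_congr_fun measurableSet_Ioi hpt,
    integral_add ((integrableOn_radial_moment_diff m hν).const_mul _) hSint,
    integral_const_mul, integral_radial_moment_diff m hν, mul_zero, zero_add]
end

section
/- (Theorem 3: unbiasedness of the combined spherical-radial rule.) Let (Ω, 𝔉, P) be a probability space, and let X : Ω → α and Y : Ω → β be independent random elements (α, β measurable spaces). Let N_s, N_r be natural numbers, let w_s : α → Fin N_s → ℝ and s : α → Fin N_s → ℝⁿ be measurable node/weight functions for a randomized spherical rule, let w_r : β → Fin N_r → ℝ and r : β → Fin N_r → ℝ be measurable node/weight functions for a randomized radial rule, let l : ℝⁿ → ℝ be measurable, let S : ℝ → ℝ, and let I ∈ ℝ. Assume: (i) for every ρ ∈ ℝ, E_P[∑_{i=1}^{N_s} w_s(X)_i · l(ρ • s(X)_i)] = S(ρ) (the spherical rule is unbiased); (ii) E_P[∑_{j=1}^{N_r} w_r(Y)_j · S(r(Y)_j)]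 = I (the radial rule is unbiased); and (iii) the function ω ↦ ∑_{j=1}^{N_r} ∑_{i=1}^{N_s} w_r(Y(ω))_j · w_s(X(ω))_i · l(r(Y(ω))_j • s(X(ω))_i) is integrable, as is, for P-almost every value y of Y and each j, the function ω ↦ ∑_i w_s(X(ω))_i l(r(y)_j • s(X(ω))_i). Then E_P[∑_{j=1}^{N_r} ∑_{i=1}^{N_s} w_r(Y)_j · w_s(X)_i · l(r(Y)_j • s(X)_i)] = I. -/
open MeasureTheory ProbabilityTheory

/-- Theorem 3: if a randomized spherical rule and a randomized radial rule are both unbiased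
and their random nodes/weights are independent, then the combined spherical-radial rule is
unbiased. -/
theorem spherical_radial_rule_unbiased
    {Ω α β : Type*} [MeasurableSpace Ω] [MeasurableSpace α] [MeasurableSpace β]
    (P : Measure Ω) [IsProbabilityMeasure P]
    (X : Ω → α) (Y : Ω → β) (hX : Measurable X) (hY : Measurable Y)
    (hXY : IndepFun X Y P)
    (n : ℕ) (Ns Nr : ℕ)
    (ws : α → Fin Ns → ℝ) (s : α → Fin Ns → EuclideanSpace ℝ (Fin n))
    (wr : β → Fin Nr → ℝ) (r : β → Fin Nr → ℝ)
    (hws : Measurable ws) (hs : Measurable s) (hwr : Measurable wr) (hr : Measurable r)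
    (l : EuclideanSpace ℝ (Fin n) → ℝ) (hl : Measurable l)
    (S : ℝ → ℝ) (I : ℝ)
    -- (i) the spherical rule is unbiased
    (hSph : ∀ ρ : ℝ, ∫ ω, (∑ i : Fin Ns, ws (X ω) i * l (ρ • s (X ω) i)) ∂P = S ρ)
    -- (ii) the radial rule is unbiased
    (hRad : ∫ ω, (∑ j : Fin Nr, wr (Y ω) j * S (r (Y ω) j)) ∂P = I)
    -- (iii) integrability assumptions
    (hInt : Integrable
      (fun ω => ∑ j : Fin Nr, ∑ i : Fin Ns,
        wr (Y ω) j * ws (X ω) i * l (r (Y ω) j • s (X ω) i)) P)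
    (hInt' : ∀ᵐ y ∂(P.map Y), ∀ j : Fin Nr,
      Integrable (fun ω => ∑ i : Fin Ns, ws (X ω) i * l (r y j • s (X ω) i)) P) :
    ∫ ω, (∑ j : Fin Nr, ∑ i : Fin Ns,
        wr (Y ω) j * ws (X ω) i * l (r (Y ω) j • s (X ω) i)) ∂P = I := by
  have hG : Measurable fun p : ℝ × α => ∑ i : Fin Ns, ws p.2 i * l (p.1 • s p.2 i) := by
    fun_prop
  have hF : Measurable fun p : β × α => ∑ j : Fin Nr, ∑ i : Fin Ns,
      wr p.1 j * ws p.2 i * l (r p.1 j • s p.2 i) := by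
    fun_prop
  have hSm : Measurable S := by
    have hmeas := (hG.stronglyMeasurable.integral_prod_right' (ν := P.map X)).measurable
    convert hmeas using 1
    funext ρ
    rw [← hSph ρ]
    exact (integral_map hX.aemeasurable
      (hG.comp measurable_prodMk_left).aestronglyMeasurable).symm
  have hlaw : P.map (fun ω => (Y ω, X ω)) = (P.map Y).prod (P.map X) :=
    (indepFun_iff_map_prod_eq_prod_map_map hY.aemeasurable hX.aemeasurable).1 hXY.symm
  have hYX : Measurable fun ω => (Y ω, X ω) := hY.prodMk hX
  have hIntProd : Integrable (fun p : β × α => ∑ j : Fin Nr, ∑ i : Fin Ns,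
      wr p.1 j * ws p.2 i * l (r p.1 j • s p.2 i)) ((P.map Y).prod (P.map X)) := by
    rw [← hlaw]
    exact (integrable_map_measure hF.aestronglyMeasurable hYX.aemeasurable).2 hInt
  rw [← integral_map (f := fun p : β × α => ∑ j : Fin Nr, ∑ i : Fin Ns,
      wr p.1 j * ws p.2 i * l (r p.1 j • s p.2 i)) hYX.aemeasurable hF.aestronglyMeasurable,
    hlaw, integral_prod _ hIntProd, ← hRad,
    ← integral_map (f := fun y => ∑ j : Fin Nr, wr y j * S (r y j)) hY.aemeasurable
      (by fun_prop)]
  refine integral_congr_ae ?_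
  filter_upwards [hInt'] with y hy
  refine (integral_map hX.aemeasurable
    (hF.comp measurable_prodMk_left).aestronglyMeasurable).trans ?_
  simp only [Function.comp_apply, mul_assoc, ← Finset.mul_sum]
  rw [integral_finsetSum _ fun j _ => (hy j).const_mul _]
  simp only [integral_const_mul, hSph]
end

section
/- (Unbiasedness of the third-degree spherical rule.) Let n ≥ 1 be an integer, r > 0, and let l : ℝⁿ → ℝ be such that s ↦ l(r·s) is integrable on the unit sphere U_n with respect to the surface measure σ. Let μ_H be the Haar probability measure on the orthogonal group O(n), and let e_1, …, e_n be the standard basis vectors of ℝⁿ. Then ∫_{O(n)} (A_n/(2n)) ∑_{i=1}^{n} [ l(-r Q e_i) + l(r Q e_i) ] dμ_H(Q) = ∫_{U_n} l(r·s) dσ(s), where A_n = 2π^{n/2}/Γ(n/2). -/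
open Real MeasureTheory Matrix

instance matrixMeasurableSpace (n : ℕ) : MeasurableSpace (Matrix (Fin n) (Fin n) ℝ) :=
  MeasurableSpace.pi

/-- Invariance determines a measure up to its total mass: averaging `f` over an orbit of
a transitive action against an invariant probability measure computes the mean of `f`. -/
theorem lintegral_smul_mul_measure_univ {G X : Type*} [Group G] [MeasurableSpace G]
    [MeasurableMul G] [MeasurableInv G] [MeasurableSpace X] [MulAction G X] [MeasurableSMul₂ G X]
    [MulAction.IsPretransitive G X] (μ : Measure G) [IsProbabilityMeasure μ]
    [μ.IsMulLeftInvariant] (σ : Measure X) [SFinite σ] [SMulInvariantMeasure G X σ]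
    (u : X) {f : X → ENNReal} (hf : Measurable f) :
    (∫⁻ g, f (g • u) ∂μ) * σ Set.univ = ∫⁻ x, f x ∂σ := by
  have inv_eq (x : X) : ∫⁻ g, f (g • x) ∂μ = ∫⁻ g, f (g⁻¹ • x) ∂μ :=
    calc ∫⁻ g, f (g • x) ∂μ = ∫⁻ h, ∫⁻ g, f ((h⁻¹ * g) • x) ∂μ ∂μ := by
          simp [lintegral_mul_left_eq_self (fun g : G => f (g • x))]
      _ = ∫⁻ g, ∫⁻ h, f ((h⁻¹ * g) • x) ∂μ ∂μ := by
          refine lintegral_lintegral_swap (Measurable.aemeasurable ?_)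
          simp only [Function.uncurry_def, mul_smul]
          fun_prop
      _ = ∫⁻ g, f (g⁻¹ • x) ∂μ := by
          simp_rw [fun g : G =>
            (lintegral_mul_left_eq_self (μ := μ) (fun h : G => f ((h⁻¹ * g) • x)) g).symm]
          simp
  have indep (x : X) : ∫⁻ g, f (g • x) ∂μ = ∫⁻ g, f (g • u) ∂μ := by
    obtain ⟨a, rfl⟩ := MulAction.exists_smul_eq G u x
    rw [inv_eq, inv_eq, ← lintegral_mul_left_eq_self _ a]
    simp [mul_smul]
  calc (∫⁻ g, f (g • u) ∂μ) * σ Set.univ = ∫⁻ x, ∫⁻ g, f (g • x) ∂μ ∂σ := by simp [indep]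
    _ = ∫⁻ g, ∫⁻ x, f (g • x) ∂σ ∂μ := by
        refine lintegral_lintegral_swap (Measurable.aemeasurable ?_)
        simp only [Function.uncurry_def]
        fun_prop
    _ = ∫⁻ x, f x ∂σ := by
        simp [fun g : G => (measurePreserving_smul g σ).lintegral_comp hf]

/-- Orbit maps of a transitive action push an invariant probability measure to the normalized
invariant measure. -/
theorem map_smul_eq_smul {G X : Type*} [Group G] [MeasurableSpace G]
    [MeasurableMul G] [MeasurableInv G] [MeasurableSpace X] [MulAction G X] [MeasurableSMul₂ G X]
    [MulAction.IsPretransitive G X] (μ : Measure G) [IsProbabilityMeasure μ]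
    [μ.IsMulLeftInvariant] (σ : Measure X) [IsFiniteMeasure σ] [NeZero σ]
    [SMulInvariantMeasure G X σ] (u : X) :
    μ.map (fun g => g • u) = (σ Set.univ)⁻¹ • σ := by
  refine Measure.ext_of_lintegral _ fun f hf => ?_
  rw [lintegral_map hf (by fun_prop), lintegral_smul_measure,
    ← lintegral_smul_mul_measure_univ μ σ u hf, smul_eq_mul, mul_comm, mul_assoc,
    ENNReal.mul_inv_cancel (NeZero.ne _) (measure_ne_top _ _), mul_one]

namespace OrthogonalSphere

variable {n : ℕ}

open scoped Pointwise

local notation "O" n => Matrix.orthogonalGroup (Fin n) ℝ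
local notation "S" n => Metric.sphere (0 : EuclideanSpace ℝ (Fin n)) 1

/-- Orthogonal matrices are the linear isometries of Euclidean space. -/
noncomputable def isometryEquiv :
    (O n) ≃* (EuclideanSpace ℝ (Fin n) ≃ₗᵢ[ℝ] EuclideanSpace ℝ (Fin n)) :=
  (Unitary.mapEquiv (StarMulEquiv.ofClass
    (Matrix.toEuclideanCLM (n := Fin n) (𝕜 := ℝ)))).toMulEquiv.trans Unitary.linearIsometryEquiv

theorem isometryEquiv_apply (Q : O n) (x : EuclideanSpace ℝ (Fin n)) :
    isometryEquiv Q x = Matrix.toEuclideanLin (Q : Matrix (Fin n) (Fin n) ℝ) x := rfl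

noncomputable instance : MulAction (O n) (S n) where
  smul Q s := ⟨isometryEquiv Q s, by simp⟩
  one_smul s := Subtype.ext (congrArg (fun f => f (s : EuclideanSpace ℝ (Fin n)))
    (map_one (isometryEquiv (n := n))))
  mul_smul P Q s := Subtype.ext (congrArg (fun f => f (s : EuclideanSpace ℝ (Fin n)))
    (map_mul (isometryEquiv (n := n)) P Q))

theorem coe_smul (Q : O n) (s : S n) :
    ((Q • s : S n) : EuclideanSpace ℝ (Fin n)) = isometryEquiv Q s := rfl

instance : MulAction.IsPretransitive (O n) (S n) where
  exists_smul_eq s t := by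
    refine ⟨isometryEquiv.symm (ℝ ∙ (s - t : EuclideanSpace ℝ (Fin n)))ᗮ.reflection,
      Subtype.ext ?_⟩
    rw [coe_smul, MulEquiv.apply_symm_apply]
    exact Submodule.reflection_sub (by simp)

instance : MeasurableInv (O n) where
  measurable_inv := by
    refine Measurable.subtype_mk (measurable_pi_iff.2 fun i => measurable_pi_iff.2 fun j => ?_)
    exact (measurable_pi_apply i).comp ((measurable_pi_apply j).comp measurable_subtype_coe)

instance : MeasurableMul (O n) where
  measurable_const_mul P := by
    refine Measurable.subtype_mk (measurable_pi_iff.2 fun i => measurable_pi_iff.2 fun j => ?_)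
    simp only [Matrix.mul_apply]
    refine Finset.measurable_sum _ fun k _ => Measurable.const_mul ?_ _
    exact (measurable_pi_apply j).comp ((measurable_pi_apply k).comp measurable_subtype_coe)
  measurable_mul_const P := by
    refine Measurable.subtype_mk (measurable_pi_iff.2 fun i => measurable_pi_iff.2 fun j => ?_)
    simp only [Matrix.mul_apply]
    refine Finset.measurable_sum _ fun k _ => Measurable.mul_const ?_ _
    exact (measurable_pi_apply k).comp ((measurable_pi_apply i).comp measurable_subtype_coe)

instance : MeasurableSMul₂ (O n) (S n) where
  measurable_smul := by
    refine Measurable.subtype_mk ((WithLp.measurable_toLp 2 (Fin n → ℝ)).comp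
      (f := fun p : (O n) × (S n) => (isometryEquiv p.1 p.2).ofLp)
      (measurable_pi_iff.2 fun i => ?_))
    simp only [isometryEquiv_apply, Matrix.ofLp_toLpLin, Matrix.toLin'_apply,
      Matrix.mulVec, dotProduct]
    refine Finset.measurable_sum _ fun k _ => Measurable.mul ?_ ?_
    · exact (measurable_pi_apply k).comp
        ((measurable_pi_apply i).comp (measurable_subtype_coe.comp measurable_fst))
    · exact (measurable_pi_apply k).comp ((WithLp.measurable_ofLp 2 _).comp
        (measurable_subtype_coe.comp measurable_snd))

instance : SMulInvariantMeasure (O n) (S n)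
    (volume : Measure (EuclideanSpace ℝ (Fin n))).toSphere where
  measure_preimage_smul Q s hs := by
    rw [Measure.toSphere_apply' _ hs, Measure.toSphere_apply' _ (measurable_const_smul Q hs),
      ← (isometryEquiv Q).measurePreserving.measure_preimage_emb
        (isometryEquiv Q).toHomeomorph.measurableEmbedding
        (Set.Ioo (0 : ℝ) 1 • (Subtype.val '' s))]
    congr 2
    ext x
    simp only [Set.mem_smul, Set.mem_image, Set.mem_preimage]
    constructor
    · rintro ⟨a, ha, _, ⟨y, hy, rfl⟩, rfl⟩
      exact ⟨a, ha, _, ⟨Q • y, hy, rfl⟩, by simp [coe_smul]⟩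
    · rintro ⟨a, ha, _, ⟨y, hy, rfl⟩, h⟩
      refine ⟨a, ha, _, ⟨Q⁻¹ • y, by simpa using hy, rfl⟩, (isometryEquiv Q).injective ?_⟩
      rw [map_smul, ← coe_smul, smul_inv_smul, h]

/-- The surface area of the unit sphere of Euclidean space. -/
theorem toSphere_real_univ [NeZero n] :
    (volume : Measure (EuclideanSpace ℝ (Fin n))).toSphere.real Set.univ =
      2 * Real.pi ^ ((n : ℝ) / 2) / Real.Gamma ((n : ℝ) / 2) := by
  have hn : (0 : ℝ) < n := Nat.cast_pos.2 (NeZero.pos n)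
  have hΓ : 0 < Real.Gamma ((n : ℝ) / 2) := Real.Gamma_pos_of_pos (by positivity)
  have hpi : √Real.pi ^ n = Real.pi ^ ((n : ℝ) / 2) := by
    rw [Real.sqrt_eq_rpow, ← Real.rpow_natCast, ← Real.rpow_mul Real.pi_pos.le]
    ring_nf
  rw [Measure.toSphere_real_apply_univ, measureReal_def, EuclideanSpace.volume_ball,
    Real.Gamma_add_one (by positivity)]
  simp only [ENNReal.ofReal_one, one_pow, one_mul, Fintype.card_fin, finrank_euclideanSpace, hpi]
  rw [ENNReal.toReal_ofReal (by positivity)]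
  field_simp

/-- The orbit average of `f` under the orthogonal group is its mean over the sphere. -/
theorem integrable_and_integral_smul [NeZero n] (μ : Measure (O n)) [IsProbabilityMeasure μ]
    [μ.IsMulLeftInvariant] {f : (S n) → ℝ}
    (hf : Integrable f (volume : Measure (EuclideanSpace ℝ (Fin n))).toSphere) (u : S n) :
    Integrable (fun Q => f (Q • u)) μ ∧
      ∫ Q, f (Q • u) ∂μ =
        ((volume : Measure (EuclideanSpace ℝ (Fin n))).toSphere.real Set.univ)⁻¹ *
          ∫ s, f s ∂(volume : Measure (EuclideanSpace ℝ (Fin n))).toSphere := by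
  set σ := (volume : Measure (EuclideanSpace ℝ (Fin n))).toSphere
  have : NeZero σ := ⟨Measure.toSphere_ne_zero _⟩
  have hm : Measurable fun Q : O n => Q • u := by fun_prop
  have hmap := map_smul_eq_smul μ σ u
  have hint : Integrable f (μ.map fun Q => Q • u) := by
    rw [hmap]
    exact hf.smul_measure (by simp [NeZero.ne])
  refine ⟨hint.comp_measurable hm, ?_⟩
  rw [← integral_map hm.aemeasurable hint.aestronglyMeasurable, hmap, integral_smul_measure]
  simp [measureReal_def]

end OrthogonalSphere

/-- Unbiasedness of the third-degree spherical rule: for `r > 0` and `l` with `s ↦ l(r·s)`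
integrable on the unit sphere w.r.t. the surface measure `σ` (Mathlib's `volume.toSphere`,
of total mass `Aₙ = 2π^(n/2)/Γ(n/2)`), and `μH` the Haar (left-invariant) probability
measure on `O(n)`,
`∫_{O(n)} (Aₙ/(2n)) ∑ᵢ [l(-r Q eᵢ) + l(r Q eᵢ)] dμH(Q) = ∫_{Uₙ} l(r·s) dσ(s)`. -/
theorem spherical_rule_unbiased (n : ℕ) (hn : 1 ≤ n)
    (μH : Measure (Matrix.orthogonalGroup (Fin n) ℝ)) [IsProbabilityMeasure μH]
    [μH.IsMulLeftInvariant]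
    (r : ℝ) (hr : 0 < r) (l : EuclideanSpace ℝ (Fin n) → ℝ)
    (hl : Integrable (fun s : Metric.sphere (0 : EuclideanSpace ℝ (Fin n)) 1 =>
        l (r • (s : EuclideanSpace ℝ (Fin n))))
      (volume : Measure (EuclideanSpace ℝ (Fin n))).toSphere) :
    ∫ Q : Matrix.orthogonalGroup (Fin n) ℝ,
        (2 * Real.pi ^ ((n : ℝ) / 2) / Real.Gamma ((n : ℝ) / 2)) / (2 * n) *
          ∑ i : Fin n,
            (l (-(r • Matrix.toEuclideanLin (Q : Matrix (Fin n) (Fin n) ℝ)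
                (EuclideanSpace.single i 1))) +
             l (r • Matrix.toEuclideanLin (Q : Matrix (Fin n) (Fin n) ℝ)
                (EuclideanSpace.single i 1))) ∂μH =
      ∫ s : Metric.sphere (0 : EuclideanSpace ℝ (Fin n)) 1,
        l (r • (s : EuclideanSpace ℝ (Fin n)))
        ∂(volume : Measure (EuclideanSpace ℝ (Fin n))).toSphere := by
  have : NeZero n := ⟨by omega⟩
  have key := OrthogonalSphere.integrable_and_integral_smul μH hl
  have hA := OrthogonalSphere.toSphere_real_univ (n := n)
  have hA0 : (volume : Measure (EuclideanSpace ℝ (Fin n))).toSphere.real Set.univ ≠ 0 := by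
    rw [hA]
    have : 0 < Real.Gamma ((n : ℝ) / 2) :=
      Real.Gamma_pos_of_pos (by have := NeZero.pos n; positivity)
    positivity
  have hn0 : (n : ℝ) ≠ 0 := NeZero.ne _
  let e (i : Fin n) : Metric.sphere (0 : EuclideanSpace ℝ (Fin n)) 1 :=
    ⟨EuclideanSpace.single i 1, by simp⟩
  have hterm (Q : Matrix.orthogonalGroup (Fin n) ℝ) (i : Fin n) :
      l (-(r • Matrix.toEuclideanLin (Q : Matrix (Fin n) (Fin n) ℝ)
          (EuclideanSpace.single i 1))) +
        l (r • Matrix.toEuclideanLin (Q : Matrix (Fin n) (Fin n) ℝ)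
          (EuclideanSpace.single i 1)) =
      l (r • (Q • -e i : Metric.sphere (0 : EuclideanSpace ℝ (Fin n)) 1)) +
        l (r • (Q • e i : Metric.sphere (0 : EuclideanSpace ℝ (Fin n)) 1)) := by
    simp only [OrthogonalSphere.coe_smul, coe_neg_sphere, map_neg, smul_neg,
      OrthogonalSphere.isometryEquiv_apply, e]
  simp_rw [hterm]
  rw [integral_const_mul, integral_finsetSum Finset.univ
    (f := fun i Q => l (r • (Q • -e i : Metric.sphere (0 : EuclideanSpace ℝ (Fin n)) 1)) +
      l (r • (Q • e i : Metric.sphere (0 : EuclideanSpace ℝ (Fin n)) 1)))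
    fun i _ => (key (-e i)).1.add (key (e i)).1]
  simp_rw [fun i => integral_add (key (-e i)).1 (key (e i)).1, fun u => (key u).2]
  rw [← hA, Finset.sum_const, Finset.card_univ, Fintype.card_fin, nsmul_eq_mul]
  field_simp
  ring
end

section
/- (Unbiasedness of the stochastic Student's t spherical-radial cubature rule, equation (50).) Let n ≥ 1 be an integer, ν > 2 a real number, μ ∈ ℝⁿ, A an invertible real n×n matrix with Σ = A Aᵀ, and g : ℝⁿ → ℝ such that x ↦ g(x) St(x; μ, Σ, ν) is Lebesgue integrable on ℝⁿ. Let μ_H be the Haar probability measure on the orthogonal group O(n), let μ_r be the probability measure on (0,∞) with density p(r) = 2 r^{n+1} (1+r²)^{-(ν+n)/2} / B((n+2)/2, (ν-2)/2), and consider the product measure μ_H ⊗ μ_r (so Q and r₂ are independent). Assume the integrand below is integrable with respect to μ_H ⊗ μ_r. Then ∫∫ { [1 - n/((ν-2) r₂²)] g(μ) + (1/(2(ν-2) r₂²)) ∑_{i=1}^{n} [ g(μ - r₂ √ν A Q e_i) + g(μ + r₂ √ν A Q e_i) ] } dμ_H(Q) dμ_r(r₂) = ∫_{ℝⁿ} g(x)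 St(x; μ, Σ, ν) dx. -/
open Real MeasureTheory Matrix Set

/-- The law of the radial quadrature point: the measure on `(0,∞)` with density `p`. -/
noncomputable def radialLaw (n : ℕ) (ν : ℝ) : Measure ℝ :=
  (volume.restrict (Ioi (0 : ℝ))).withDensity fun r => ENNReal.ofReal (radialPDF n ν r)

/-- The `n`-dimensional Student's t probability density with mean vector `μ`,
scale matrix `Σ` and degrees-of-freedom parameter `ν`. -/
noncomputable def StPDF (n : ℕ) (μ : Fin n → ℝ) (Sig : Matrix (Fin n) (Fin n) ℝ) (ν : ℝ)
    (x : Fin n → ℝ) : ℝ :=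
  (Real.Gamma ((ν + n) / 2) / Real.Gamma (ν / 2)) * (ν * Real.pi) ^ (-(n : ℝ) / 2) *
    Sig.det ^ (-(1 : ℝ) / 2) *
    (1 + (1 / ν) * ((x - μ) ⬝ᵥ (Sig⁻¹ *ᵥ (x - μ)))) ^ (-((ν + n) / 2))

theorem orthogonalGroup_measurable_apply {n : ℕ} (a b : Fin n) :
    Measurable fun M : Matrix.orthogonalGroup (Fin n) ℝ =>
      (M : Matrix (Fin n) (Fin n) ℝ) a b :=
  (measurable_pi_apply b).comp ((measurable_pi_apply a).comp measurable_subtype_coe)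

theorem orthogonalGroup_measurable_mulVec (n : ℕ) :
    Measurable fun p : Matrix.orthogonalGroup (Fin n) ℝ × (Fin n → ℝ) =>
      (p.1 : Matrix (Fin n) (Fin n) ℝ) *ᵥ p.2 := by
  refine measurable_pi_iff.2 fun a => ?_
  simp only [mulVec, dotProduct]
  exact Finset.measurable_sum _ fun b _ =>
    ((orthogonalGroup_measurable_apply a b).comp measurable_fst).mul
      ((measurable_pi_apply b).comp measurable_snd)

instance orthogonalGroup_measurableMul₂ (n : ℕ) :
    MeasurableMul₂ (Matrix.orthogonalGroup (Fin n) ℝ) where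
  measurable_mul := by
    refine Measurable.subtype_mk (measurable_pi_iff.2 fun i => measurable_pi_iff.2 fun j => ?_)
    simp only [Matrix.mul_apply]
    exact Finset.measurable_sum _ fun k _ =>
      ((orthogonalGroup_measurable_apply i k).comp measurable_fst).mul
        ((orthogonalGroup_measurable_apply k j).comp measurable_snd)

instance orthogonalGroup_measurableInv (n : ℕ) :
    MeasurableInv (Matrix.orthogonalGroup (Fin n) ℝ) where
  measurable_inv := by
    refine Measurable.subtype_mk (measurable_pi_iff.2 fun i => measurable_pi_iff.2 fun j => ?_)
    exact (measurable_pi_apply i).comp ((measurable_pi_apply j).comp measurable_subtype_coe)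

/-- A left-invariant probability measure on a group is invariant under inversion. -/
theorem lintegral_comp_inv_of_isMulLeftInvariant {G : Type*} [Group G] [MeasurableSpace G]
    [MeasurableMul₂ G] [MeasurableInv G] (m : Measure G) [IsProbabilityMeasure m]
    [m.IsMulLeftInvariant] {F : G → ENNReal} (hF : Measurable F) :
    ∫⁻ Q, F Q⁻¹ ∂m = ∫⁻ Q, F Q ∂m := by
  calc ∫⁻ Q, F Q⁻¹ ∂m = ∫⁻ _ : G, ∫⁻ P, F P⁻¹ ∂m ∂m := by simp
    _ = ∫⁻ Q, ∫⁻ P, F (P⁻¹ * Q) ∂m ∂m := by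
        refine lintegral_congr fun Q => ?_
        rw [← lintegral_mul_left_eq_self _ Q⁻¹]
        simp
    _ = ∫⁻ P, ∫⁻ Q, F (P⁻¹ * Q) ∂m ∂m := by
        refine lintegral_lintegral_swap (Measurable.aemeasurable ?_)
        exact hF.comp ((measurable_snd.inv).mul measurable_fst)
    _ = ∫⁻ Q, F Q ∂m := by simp [lintegral_mul_left_eq_self]

/-- Householder reflections show that the orthogonal group is transitive on spheres. -/
theorem exists_orthogonal_mulVec_eq {ι : Type*} [Fintype ι] [DecidableEq ι] (x y : ι → ℝ)
    (h : x ⬝ᵥ x = y ⬝ᵥ y) :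
    ∃ Q : Matrix.orthogonalGroup ι ℝ, (Q : Matrix ι ι ℝ) *ᵥ x = y := by
  by_cases hxy : x = y
  · exact ⟨1, by simp [hxy]⟩
  set v := x - y with hv
  have hv0 : v ⬝ᵥ v ≠ 0 := by
    rw [Ne, dotProduct_self_eq_zero]
    exact sub_ne_zero.2 hxy
  set c : ℝ := 2 / (v ⬝ᵥ v) with hc
  have hcv : c * (v ⬝ᵥ v) = 2 := by rw [hc]; field_simp
  have hsymm : (1 - c • vecMulVec v v)ᵀ = 1 - c • vecMulVec v v := by
    simp [transpose_vecMulVec]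
  refine ⟨⟨1 - c • vecMulVec v v, ?_⟩, ?_⟩
  · rw [Matrix.mem_orthogonalGroup_iff]
    change (1 - c • vecMulVec v v) * (1 - c • vecMulVec v v)ᵀ = 1
    rw [hsymm]
    have hsq : vecMulVec v v * vecMulVec v v = (v ⬝ᵥ v) • vecMulVec v v := by
      ext i j
      simp [Matrix.mul_apply, vecMulVec_apply, dotProduct, Finset.sum_mul]
      exact Finset.sum_congr rfl fun _ _ => by ring
    have : (c * c * (v ⬝ᵥ v)) = 2 * c := by rw [mul_assoc, hcv, mul_comm]
    simp only [sub_mul, mul_sub, one_mul, mul_one, smul_mul_smul_comm, hsq, smul_smul, this]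
    module
  · change (1 - c • vecMulVec v v) *ᵥ x = y
    have hvx : 2 * (v ⬝ᵥ x) = v ⬝ᵥ v := by
      simp only [hv, sub_dotProduct, dotProduct_sub, h, dotProduct_comm y x]
      ring
    have hcx : c * (v ⬝ᵥ x) = 1 := by linarith [hcv, congrArg (c * ·) hvx]
    rw [sub_mulVec, one_mulVec, smul_mulVec, vecMulVec_mulVec]
    ext i
    have hi : c * (v i * (v ⬝ᵥ x)) = v i := by rw [mul_left_comm, hcx, mul_one]
    simp only [Pi.sub_apply, Pi.smul_apply, smul_eq_mul, MulOpposite.smul_eq_mul_unop,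
      MulOpposite.unop_op, hi]
    simp [hv]

theorem lintegral_fun_norm_addHaar {E : Type*} [NormedAddCommGroup E] [NormedSpace ℝ E]
    [MeasurableSpace E] [BorelSpace E] [FiniteDimensional ℝ E] [Nontrivial E]
    (m : Measure E) [m.IsAddHaarMeasure] {f : ℝ → ENNReal} (hf : Measurable f) :
    ∫⁻ x, f ‖x‖ ∂m = Module.finrank ℝ E * m (Metric.ball 0 1) *
      ∫⁻ r in Ioi (0 : ℝ), ENNReal.ofReal (r ^ (Module.finrank ℝ E - 1)) * f r := by
  calc
    ∫⁻ x, f ‖x‖ ∂m = ∫⁻ x : ({(0)}ᶜ : Set E), f ‖x.1‖ ∂(m.comap (↑)) := by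
      rw [lintegral_subtype_comap (measurableSet_singleton _).compl fun x : E => f ‖x‖,
        restrict_compl_singleton]
    _ = ∫⁻ x, f x.2 ∂m.toSphere.prod (.volumeIoiPow (Module.finrank ℝ E - 1)) := by
      simpa using m.measurePreserving_homeomorphUnitSphereProd.lintegral_comp_emb
        (Homeomorph.measurableEmbedding _) (f ∘ Subtype.val ∘ Prod.snd)
    _ = m.toSphere univ *
        ∫⁻ x : Ioi (0 : ℝ), f x ∂.volumeIoiPow (Module.finrank ℝ E - 1) := by
      rw [lintegral_prod _ (by fun_prop)]
      simp [mul_comm]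
    _ = _ := by
      rw [Measure.volumeIoiPow, lintegral_withDensity_eq_lintegral_mul _ (by fun_prop)
        (by fun_prop), m.toSphere_apply_univ,
        ← lintegral_subtype_comap measurableSet_Ioi]
      rfl

/-- Polar integration, with the sphere integral replaced by an average over the orthogonal group. -/
theorem lintegral_eq_polar_orthogonalGroup {n : ℕ} (i : Fin n)
    (m : Measure (Matrix.orthogonalGroup (Fin n) ℝ)) [IsProbabilityMeasure m]
    [m.IsMulLeftInvariant] {F : (Fin n → ℝ) → ENNReal} (hF : Measurable F) :
    ∫⁻ x, F x = n * volume (Metric.ball (0 : EuclideanSpace ℝ (Fin n)) 1) *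
      ∫⁻ r in Ioi (0 : ℝ), ENNReal.ofReal (r ^ (n - 1)) *
        ∫⁻ Q, F (r • ((Q : Matrix (Fin n) (Fin n) ℝ) *ᵥ Pi.single i 1)) ∂m := by
  have : Nonempty (Fin n) := ⟨i⟩
  have hmeas := orthogonalGroup_measurable_mulVec n
  have hvol : ∀ Q : Matrix.orthogonalGroup (Fin n) ℝ,
      ∫⁻ x : Fin n → ℝ, F ((Q : Matrix (Fin n) (Fin n) ℝ) *ᵥ x) = ∫⁻ x, F x := by
    intro Q
    have hdet : |(Q : Matrix (Fin n) (Fin n) ℝ).det| = 1 := by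
      have := congrArg det ((Matrix.mem_orthogonalGroup_iff (Fin n) ℝ).1 Q.2)
      change det ((Q : Matrix (Fin n) (Fin n) ℝ) * (Q : Matrix (Fin n) (Fin n) ℝ)ᵀ) = _ at this
      rw [det_mul, det_transpose, det_one] at this
      rw [← sq_eq_sq₀ (abs_nonneg _) zero_le_one, sq_abs, sq, this, one_pow]
    have hmap := Real.map_matrix_volume_pi_eq_smul_volume_pi
      (M := (Q : Matrix (Fin n) (Fin n) ℝ)) (by rw [← abs_ne_zero, hdet]; exact one_ne_zero)
    rw [abs_inv, hdet, inv_one, ENNReal.ofReal_one, one_smul] at hmap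
    conv_rhs => rw [← hmap, lintegral_map hF (by fun_prop)]
    rfl
  set G : ℝ → ENNReal := fun r =>
    ∫⁻ Q, F (r • ((Q : Matrix (Fin n) (Fin n) ℝ) *ᵥ Pi.single i 1)) ∂m with hG
  have hFG : Measurable fun p : ℝ × Matrix.orthogonalGroup (Fin n) ℝ =>
      F (p.1 • ((p.2 : Matrix (Fin n) (Fin n) ℝ) *ᵥ Pi.single i 1)) :=
    hF.comp (measurable_fst.smul (hmeas.comp (measurable_snd.prodMk measurable_const)))
  have hGm : Measurable G := hFG.lintegral_prod_right'
  calc ∫⁻ x, F x = ∫⁻ Q, (∫⁻ x, F ((Q : Matrix (Fin n) (Fin n) ℝ) *ᵥ x)) ∂m := by simp [hvol]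
    _ = ∫⁻ x, ∫⁻ Q, F ((Q : Matrix (Fin n) (Fin n) ℝ) *ᵥ x) ∂m :=
        lintegral_lintegral_swap (hF.comp hmeas).aemeasurable
    _ = ∫⁻ x : Fin n → ℝ, G ‖(WithLp.toLp 2 x : EuclideanSpace ℝ (Fin n))‖ := by
        refine lintegral_congr fun x => ?_
        set r := ‖(WithLp.toLp 2 x : EuclideanSpace ℝ (Fin n))‖ with hr
        obtain ⟨P, hP⟩ := exists_orthogonal_mulVec_eq (r • Pi.single i 1) x (by
          rw [smul_dotProduct, dotProduct_smul, single_dotProduct, hr]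
          simp only [Pi.single_eq_same, smul_eq_mul, mul_one]
          rw [← sq, EuclideanSpace.norm_sq_eq]
          simp [dotProduct, sq])
        have hFx : Measurable fun Q : Matrix.orthogonalGroup (Fin n) ℝ =>
            F (r • ((Q : Matrix (Fin n) (Fin n) ℝ) *ᵥ Pi.single i 1)) :=
          hFG.comp measurable_prodMk_left
        have hFx' : Measurable fun Q : Matrix.orthogonalGroup (Fin n) ℝ =>
            F ((Q : Matrix (Fin n) (Fin n) ℝ) *ᵥ x) :=
          hF.comp (hmeas.comp measurable_prodMk_right)
        simp only [hG]
        rw [← lintegral_comp_inv_of_isMulLeftInvariant m hFx,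
          ← lintegral_comp_inv_of_isMulLeftInvariant m hFx',
          ← lintegral_mul_left_eq_self _ P]
        refine lintegral_congr fun Q => ?_
        have : ((P * Q)⁻¹ : Matrix.orthogonalGroup (Fin n) ℝ) * P = Q⁻¹ := by simp
        rw [← this]
        rw [← hP, Submonoid.coe_mul, ← mulVec_mulVec, ← mulVec_smul, ← mulVec_smul]
    _ = ∫⁻ x : EuclideanSpace ℝ (Fin n), G ‖x‖ :=
        (PiLp.volume_preserving_toLp (Fin n)).lintegral_comp (hGm.comp measurable_norm)
    _ = _ := by
        rw [lintegral_fun_norm_addHaar _ hGm]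
        simp only [finrank_euclideanSpace, Fintype.card_fin, hG]

/-- The measure on `(0,∞)` with density `r ↦ r ^ (n - 1)`. -/
noncomputable def polarRadialMeasure (n : ℕ) : Measure ℝ :=
  (volume.restrict (Ioi (0 : ℝ))).withDensity fun r => ENNReal.ofReal (r ^ (n - 1))

instance polarRadialMeasure_sFinite (n : ℕ) : SFinite (polarRadialMeasure n) := by
  unfold polarRadialMeasure
  infer_instance

theorem integral_polarRadialMeasure (n : ℕ) (f : ℝ → ℝ) :
    ∫ r, f r ∂polarRadialMeasure n = ∫ r in Ioi (0 : ℝ), r ^ (n - 1) * f r := by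
  rw [polarRadialMeasure, integral_withDensity_eq_integral_toReal_smul (by fun_prop) (by simp)]
  refine setIntegral_congr_fun measurableSet_Ioi fun r hr => ?_
  simp only [smul_eq_mul]
  rw [ENNReal.toReal_ofReal (pow_nonneg (le_of_lt hr) _)]

theorem integrable_polarRadialMeasure (n : ℕ) (f : ℝ → ℝ) :
    Integrable f (polarRadialMeasure n) ↔
      IntegrableOn (fun r => r ^ (n - 1) * f r) (Ioi (0 : ℝ)) := by
  rw [polarRadialMeasure, integrable_withDensity_iff_integrable_smul' (by fun_prop) (by simp)]
  refine integrableOn_congr_fun (fun r hr => ?_) measurableSet_Ioi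
  simp only [smul_eq_mul]
  rw [ENNReal.toReal_ofReal (pow_nonneg (le_of_lt hr) _)]

theorem ae_pos_polarRadialMeasure (n : ℕ) : ∀ᵐ r ∂polarRadialMeasure n, 0 < r :=
  (withDensity_absolutelyContinuous _ _).ae_le (ae_restrict_mem measurableSet_Ioi)

/-- The surface area of the unit sphere of `ℝⁿ`. -/
noncomputable def unitSphereArea (n : ℕ) : ℝ :=
  n * (√π ^ n / Real.Gamma ((n : ℝ) / 2 + 1))

theorem unitSphereArea_pos {n : ℕ} (hn : 1 ≤ n) : 0 < unitSphereArea n := by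
  unfold unitSphereArea
  have : (0 : ℝ) < n := by exact_mod_cast hn
  have := Real.Gamma_pos_of_pos (show (0 : ℝ) < (n : ℝ) / 2 + 1 by positivity)
  have := Real.pi_pos
  positivity

theorem measurable_affine_orthogonal {n : ℕ} (i : Fin n) (b : Fin n → ℝ) (s : ℝ)
    (A : Matrix (Fin n) (Fin n) ℝ) :
    Measurable fun p : Matrix.orthogonalGroup (Fin n) ℝ × ℝ =>
      b + (p.2 * s) • (A *ᵥ ((p.1 : Matrix (Fin n) (Fin n) ℝ) *ᵥ Pi.single i 1)) := by
  have hA : Measurable fun x : Fin n → ℝ => A *ᵥ x :=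
    (Continuous.matrix_mulVec continuous_const continuous_id).measurable
  exact measurable_const.add ((measurable_snd.mul measurable_const).smul
    (hA.comp ((orthogonalGroup_measurable_mulVec n).comp (measurable_fst.prodMk measurable_const))))

/-- Lebesgue measure in random polar coordinates. -/
theorem volume_eq_smul_map_orthogonal {n : ℕ} (i : Fin n) (b : Fin n → ℝ) {s : ℝ} (hs : s ≠ 0)
    {A : Matrix (Fin n) (Fin n) ℝ} (hA : A.det ≠ 0)
    (m : Measure (Matrix.orthogonalGroup (Fin n) ℝ)) [IsProbabilityMeasure m]
    [m.IsMulLeftInvariant] :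
    (volume : Measure (Fin n → ℝ)) = ENNReal.ofReal (unitSphereArea n * (|s| ^ n * |A.det|)) •
      (m.prod (polarRadialMeasure n)).map fun p =>
        b + (p.2 * s) • (A *ᵥ ((p.1 : Matrix (Fin n) (Fin n) ℝ) *ᵥ Pi.single i 1)) := by
  have : Nonempty (Fin n) := ⟨i⟩
  have hT := measurable_affine_orthogonal i b s A
  refine Measure.ext_of_lintegral _ fun F hF => ?_
  have hdet : (s • A).det ≠ 0 := by
    rw [det_smul]
    exact mul_ne_zero (pow_ne_zero _ hs) hA
  have hmap := Real.map_matrix_volume_pi_eq_smul_volume_pi hdet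
  have hlin : ∫⁻ x, F x = ENNReal.ofReal (|s| ^ n * |A.det|) *
      ∫⁻ x : Fin n → ℝ, F (b + (s • A) *ᵥ x) := by
    have hFb : Measurable fun x => F (b + x) := hF.comp (measurable_const_add b)
    have hFA : ∫⁻ x : Fin n → ℝ, F (b + (s • A) *ᵥ x) =
        ∫⁻ x, F (b + x) ∂(Measure.map (toLin' (s • A)) volume) := by
      rw [lintegral_map hFb (by fun_prop)]
      rfl
    rw [hFA, hmap, lintegral_smul_measure, lintegral_add_left_eq_self, smul_eq_mul, ← mul_assoc,
      ← ENNReal.ofReal_mul (by positivity), det_smul, Fintype.card_fin, abs_inv, abs_mul, abs_pow,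
      mul_inv_cancel₀ (by positivity), ENNReal.ofReal_one, one_mul]
  have hFA : Measurable fun x : Fin n → ℝ => F (b + (s • A) *ᵥ x) :=
    hF.comp (measurable_const.add
      (Continuous.matrix_mulVec continuous_const continuous_id).measurable)
  have hball : (n : ENNReal) * volume (Metric.ball (0 : EuclideanSpace ℝ (Fin n)) 1) =
      ENNReal.ofReal (unitSphereArea n) := by
    rw [EuclideanSpace.volume_ball, unitSphereArea, ENNReal.ofReal_mul (by positivity)]
    simp
  have hpt : ∀ (Q : Matrix.orthogonalGroup (Fin n) ℝ) (r : ℝ),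
      F (b + (s • A) *ᵥ (r • ((Q : Matrix (Fin n) (Fin n) ℝ) *ᵥ Pi.single i 1))) =
        F (b + (r * s) • (A *ᵥ ((Q : Matrix (Fin n) (Fin n) ℝ) *ᵥ Pi.single i 1))) := by
    intro Q r
    rw [mulVec_smul, smul_mulVec, smul_smul]
  have hcomp : Measurable fun p : Matrix.orthogonalGroup (Fin n) ℝ × ℝ =>
      F (b + (p.2 * s) • (A *ᵥ ((p.1 : Matrix (Fin n) (Fin n) ℝ) *ᵥ Pi.single i 1))) :=
    hF.comp hT
  rw [hlin, lintegral_eq_polar_orthogonalGroup i m hFA, lintegral_smul_measure,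
    lintegral_map hF hT, lintegral_prod_symm' _ hcomp, polarRadialMeasure,
    lintegral_withDensity_eq_lintegral_mul _ (by fun_prop) hcomp.lintegral_prod_left', hball,
    ← mul_assoc, ← ENNReal.ofReal_mul (by positivity), mul_comm (unitSphereArea n), smul_eq_mul]
  simp only [hpt]
  rfl

theorem integral_comp_affine_orthogonal {n : ℕ} (i : Fin n) (b : Fin n → ℝ) {s : ℝ} (hs : s ≠ 0)
    {A : Matrix (Fin n) (Fin n) ℝ} (hA : A.det ≠ 0)
    (m : Measure (Matrix.orthogonalGroup (Fin n) ℝ)) [IsProbabilityMeasure m]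
    [m.IsMulLeftInvariant] {f : (Fin n → ℝ) → ℝ} (hf : Integrable f) :
    Integrable (fun p : Matrix.orthogonalGroup (Fin n) ℝ × ℝ =>
        f (b + (p.2 * s) • (A *ᵥ ((p.1 : Matrix (Fin n) (Fin n) ℝ) *ᵥ Pi.single i 1))))
      (m.prod (polarRadialMeasure n)) ∧
    ∫ p : Matrix.orthogonalGroup (Fin n) ℝ × ℝ,
        f (b + (p.2 * s) • (A *ᵥ ((p.1 : Matrix (Fin n) (Fin n) ℝ) *ᵥ Pi.single i 1)))
        ∂(m.prod (polarRadialMeasure n)) =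
      (unitSphereArea n * (|s| ^ n * |A.det|))⁻¹ * ∫ x, f x := by
  have hT := measurable_affine_orthogonal i b s A
  have hvol := volume_eq_smul_map_orthogonal i b hs hA m
  have hpos : 0 < unitSphereArea n * (|s| ^ n * |A.det|) :=
    mul_pos (unitSphereArea_pos (Fin.pos i)) (by positivity)
  rw [hvol, integrable_smul_measure (by simpa using hpos) (by simp)] at hf
  refine ⟨(integrable_map_measure hf.1 hT.aemeasurable).1 hf, ?_⟩
  rw [hvol, integral_smul_measure, integral_map hT.aemeasurable hf.1,
    ENNReal.toReal_ofReal hpos.le, smul_eq_mul, inv_mul_cancel_left₀ hpos.ne']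

/-- `r² - n / (ν - 2)` has integral zero against the unnormalized radial density
`r ^ (n - 1) * (1 + r²) ^ (-(ν + n) / 2)`. -/
theorem radial_moment_identity {n : ℕ} (hn : 1 ≤ n) {ν : ℝ} (hν : 2 < ν) :
    Integrable (fun r : ℝ => (r ^ 2 - n / (ν - 2)) * (1 + r ^ 2) ^ (-((ν + n) / 2)))
      (polarRadialMeasure n) ∧
    ∫ r, (r ^ 2 - n / (ν - 2)) * (1 + r ^ 2) ^ (-((ν + n) / 2)) ∂polarRadialMeasure n = 0 := by
  have hν2 : 0 < ν - 2 := by linarith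
  have hb : ∀ r : ℝ, 0 < 1 + r ^ 2 := fun r => by positivity
  have hbase : Integrable fun r : ℝ => (1 + r ^ 2) ^ (-((ν - 1) / 2)) := by
    have := integrable_rpow_neg_one_add_norm_sq (E := ℝ) (μ := volume) (r := ν - 1)
      (by simp; linarith)
    simpa only [Real.norm_eq_abs, sq_abs, neg_div] using this
  have hint : ∀ k : ℕ, k ≤ n + 1 →
      Integrable fun r : ℝ => r ^ k * (1 + r ^ 2) ^ (-((ν + n) / 2)) := by
    intro k hk
    refine hbase.mono' (Measurable.aestronglyMeasurable (by fun_prop)) (.of_forall fun r => ?_)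
    rw [norm_mul, norm_pow, Real.norm_of_nonneg (Real.rpow_nonneg (hb r).le _)]
    have h1 : ‖r‖ ^ k ≤ (1 + r ^ 2) ^ (((n : ℝ) + 1) / 2) := by
      calc ‖r‖ ^ k ≤ √(1 + r ^ 2) ^ k := by
            gcongr
            rw [Real.norm_eq_abs]
            exact Real.abs_le_sqrt (by linarith)
        _ ≤ √(1 + r ^ 2) ^ (n + 1) :=
            pow_le_pow_right₀ (Real.one_le_sqrt.2 (by nlinarith [sq_nonneg r])) hk
        _ = _ := by
            rw [Real.sqrt_eq_rpow, ← Real.rpow_natCast, ← Real.rpow_mul (hb r).le]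
            push_cast
            ring_nf
    calc ‖r‖ ^ k * (1 + r ^ 2) ^ (-((ν + n) / 2))
        ≤ (1 + r ^ 2) ^ (((n : ℝ) + 1) / 2) * (1 + r ^ 2) ^ (-((ν + n) / 2)) := by gcongr
      _ = _ := by
        rw [← Real.rpow_add (hb r)]
        ring_nf
  have hfun : (fun r : ℝ => r ^ (n - 1) * ((r ^ 2 - n / (ν - 2)) * (1 + r ^ 2) ^ (-((ν + n) / 2))))
      = fun r => (-(ν - 2)⁻¹) * (n * (r ^ (n - 1) * (1 + r ^ 2) ^ (-((ν + n) / 2))) -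
          (ν - 2) * (r ^ (n + 1) * (1 + r ^ 2) ^ (-((ν + n) / 2)))) := by
    ext r
    obtain ⟨k, rfl⟩ : ∃ k, n = k + 1 := ⟨n - 1, by omega⟩
    field_simp
    simp only [Nat.add_sub_cancel]
    ring
  have hD : Integrable fun r : ℝ => (n * (r ^ (n - 1) * (1 + r ^ 2) ^ (-((ν + n) / 2))) -
          (ν - 2) * (r ^ (n + 1) * (1 + r ^ 2) ^ (-((ν + n) / 2)))) :=
    ((hint (n - 1) (by omega)).const_mul _).sub ((hint (n + 1) le_rfl).const_mul _)
  rw [integrable_polarRadialMeasure, integral_polarRadialMeasure, hfun]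
  refine ⟨(hD.const_mul _).integrableOn, ?_⟩
  have hderiv : ∀ r ∈ Ioi (0 : ℝ), HasDerivAt (fun r : ℝ => r ^ n * (1 + r ^ 2) ^ (1 - (ν + n) / 2))
      (n * (r ^ (n - 1) * (1 + r ^ 2) ^ (-((ν + n) / 2))) -
          (ν - 2) * (r ^ (n + 1) * (1 + r ^ 2) ^ (-((ν + n) / 2)))) r := by
    intro r _
    have h1 : HasDerivAt (fun r : ℝ => 1 + r ^ 2) (2 * r) r := by
      simpa using (hasDerivAt_pow 2 r).const_add 1
    have h2 := (hasDerivAt_pow n r).mul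
      (h1.rpow_const (p := 1 - (ν + n) / 2) (Or.inl (hb r).ne'))
    refine HasDerivAt.congr_deriv h2 ?_
    have e1 : (1 + r ^ 2) ^ (1 - (ν + n) / 2) = (1 + r ^ 2) * (1 + r ^ 2) ^ (-((ν + n) / 2)) := by
      rw [sub_eq_add_neg, Real.rpow_add (hb r), Real.rpow_one]
    have e2 : 1 - (ν + n) / 2 - 1 = -((ν + n) / 2) := by ring
    rw [e1, e2]
    obtain ⟨k, rfl⟩ : ∃ k, n = k + 1 := ⟨n - 1, by omega⟩
    simp only [Nat.add_sub_cancel]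
    push_cast
    ring
  have hlim : Filter.Tendsto (fun r : ℝ => r ^ n * (1 + r ^ 2) ^ (1 - (ν + n) / 2))
      Filter.atTop (nhds 0) := by
    have h0 := tendsto_rpow_neg_atTop hν2
    refine squeeze_zero' ?_ ?_ h0
    · filter_upwards [Filter.eventually_gt_atTop 0] with r hr
      positivity
    · filter_upwards [Filter.eventually_gt_atTop 0] with r hr
      calc r ^ n * (1 + r ^ 2) ^ (1 - (ν + n) / 2)
          ≤ r ^ n * (r ^ 2) ^ (1 - (ν + n) / 2) := by
            refine mul_le_mul_of_nonneg_left ?_ (by positivity)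
            refine Real.rpow_le_rpow_of_nonpos (by positivity)
              (le_add_of_nonneg_left zero_le_one) ?_
            have : (0 : ℝ) ≤ n := by positivity
            linarith
        _ = r ^ (-(ν - 2)) := by
            rw [← Real.rpow_natCast r n, ← Real.rpow_natCast r 2, ← Real.rpow_mul hr.le,
              ← Real.rpow_add hr]
            push_cast
            ring_nf
  have hcont : ContinuousWithinAt (fun r : ℝ => r ^ n * (1 + r ^ 2) ^ (1 - (ν + n) / 2))
      (Ici 0) 0 := by
    refine Continuous.continuousWithinAt ?_
    exact (continuous_pow n).mul ((by fun_prop : Continuous fun r : ℝ => 1 + r ^ 2).rpow_const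
      fun r => Or.inl (hb r).ne')
  rw [integral_const_mul, integral_Ioi_of_hasDerivAt_of_tendsto hcont hderiv hD.integrableOn hlim]
  have : n ≠ 0 := by omega
  simp [this]

theorem radialLaw_eq_withDensity {n : ℕ} (hn : 1 ≤ n) (ν : ℝ) :
    radialLaw n ν = (polarRadialMeasure n).withDensity fun r =>
      ENNReal.ofReal (2 * r ^ 2 * (1 + r ^ 2) ^ (-((ν + n) / 2)) /
        Beta (((n : ℝ) + 2) / 2) ((ν - 2) / 2)) := by
  rw [radialLaw, polarRadialMeasure, ← withDensity_mul _ (by fun_prop) (by fun_prop)]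
  refine withDensity_congr_ae ?_
  filter_upwards [ae_restrict_mem measurableSet_Ioi] with r hr
  rw [Pi.mul_apply, ← ENNReal.ofReal_mul (pow_nonneg (le_of_lt hr) _), radialPDF]
  obtain ⟨k, rfl⟩ : ∃ k, n = k + 1 := ⟨n - 1, by omega⟩
  simp only [Nat.add_sub_cancel]
  congr 1
  ring

theorem StPDF_affine_orthogonal {n : ℕ} (i : Fin n) {ν : ℝ} (hν : 0 < ν) (μ : Fin n → ℝ)
    {A : Matrix (Fin n) (Fin n) ℝ} (hA : IsUnit A.det) {s : ℝ} (hs : s ^ 2 = ν)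
    (Q : Matrix.orthogonalGroup (Fin n) ℝ) (r : ℝ) :
    StPDF n μ (A * Aᵀ) ν
        (μ + (r * s) • (A *ᵥ ((Q : Matrix (Fin n) (Fin n) ℝ) *ᵥ Pi.single i 1))) =
      (Real.Gamma ((ν + n) / 2) / Real.Gamma (ν / 2)) * (ν * Real.pi) ^ (-(n : ℝ) / 2) *
        (A * Aᵀ).det ^ (-(1 : ℝ) / 2) * (1 + r ^ 2) ^ (-((ν + n) / 2)) := by
  set u := (Q : Matrix (Fin n) (Fin n) ℝ) *ᵥ Pi.single i 1 with hu
  have huu : u ⬝ᵥ u = 1 := by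
    have hQ : (Q : Matrix (Fin n) (Fin n) ℝ)ᵀ * (Q : Matrix (Fin n) (Fin n) ℝ) = 1 :=
      (Matrix.mem_orthogonalGroup_iff' (Fin n) ℝ).1 Q.2
    rw [hu, dotProduct_mulVec, ← mulVec_transpose, mulVec_mulVec, hQ, one_mulVec]
    simp
  clear_value u
  have hquad : (A *ᵥ u) ⬝ᵥ ((A * Aᵀ)⁻¹ *ᵥ (A *ᵥ u)) = 1 := by
    rw [Matrix.mul_inv_rev, mulVec_mulVec, Matrix.mul_assoc, nonsing_inv_mul _ hA, Matrix.mul_one,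
      dotProduct_mulVec, ← mulVec_transpose, mulVec_mulVec, transpose_nonsing_inv,
      transpose_transpose, nonsing_inv_mul _ hA, one_mulVec, huu]
  have hval : 1 / ν * (((r * s) • (A *ᵥ u)) ⬝ᵥ ((A * Aᵀ)⁻¹ *ᵥ ((r * s) • (A *ᵥ u)))) = r ^ 2 := by
    rw [mulVec_smul, dotProduct_smul, smul_dotProduct, hquad, smul_eq_mul, smul_eq_mul, mul_one,
      ← sq, mul_pow, hs]
    field_simp
  rw [StPDF, add_sub_cancel_left, hval]

theorem normalization_identity {n : ℕ} (hn : 1 ≤ n) {ν : ℝ} (hν : 2 < ν) {d : ℝ} (hd : d ≠ 0)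
    {D : ℝ} (hD : D = d * d) :
    2 * n * (Beta (((n : ℝ) + 2) / 2) ((ν - 2) / 2) * (ν - 2))⁻¹ *
        (unitSphereArea n * (√ν ^ n * |d|))⁻¹ =
      (Real.Gamma ((ν + n) / 2) / Real.Gamma (ν / 2)) * (ν * Real.pi) ^ (-(n : ℝ) / 2) *
        D ^ (-(1 : ℝ) / 2) := by
  have hν0 : 0 < ν := by linarith
  have hν2 : 0 < ν - 2 := by linarith
  have hn0 : (0 : ℝ) < n := by exact_mod_cast hn
  have hsqrt : D ^ (-(1 : ℝ) / 2) = |d|⁻¹ := by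
    rw [hD, neg_div, Real.rpow_neg (mul_self_nonneg d), ← Real.sqrt_eq_rpow, Real.sqrt_mul_self_eq_abs]
  have hpow : ∀ x : ℝ, 0 < x → x ^ (-(n : ℝ) / 2) = (√x ^ n)⁻¹ := by
    intro x hx
    rw [Real.sqrt_eq_rpow, ← Real.rpow_natCast, ← Real.rpow_mul hx.le, ← Real.rpow_neg hx.le]
    ring_nf
  have hΓ : Real.Gamma (ν / 2) = (ν - 2) / 2 * Real.Gamma ((ν - 2) / 2) := by
    rw [← Real.Gamma_add_one (by positivity)]
    ring_nf
  have h1 := Real.Gamma_pos_of_pos (show 0 < (ν - 2) / 2 by positivity)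
  have h2 := Real.Gamma_pos_of_pos (show 0 < (n : ℝ) / 2 + 1 by positivity)
  have h3 := Real.Gamma_pos_of_pos (show 0 < (ν + n) / 2 by positivity)
  have hsν : 0 < √ν := Real.sqrt_pos.2 hν0
  have hsπ : 0 < √π := Real.sqrt_pos.2 Real.pi_pos
  have hd' : |d| ≠ 0 := abs_ne_zero.2 hd
  rw [hsqrt, hpow _ (mul_pos hν0 Real.pi_pos), Real.sqrt_mul hν0.le, mul_pow, Beta, unitSphereArea,
    hΓ, show ((n : ℝ) + 2) / 2 + (ν - 2) / 2 = (ν + n) / 2 by ring,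
    show ((n : ℝ) + 2) / 2 = (n : ℝ) / 2 + 1 by ring]
  field_simp

/-- Unbiasedness of the stochastic Student's t spherical-radial cubature rule (eq. (50)):
with `Q` Haar-distributed on `O(n)` and `r₂` distributed with density `p`, independently,
the expectation of the random cubature rule equals `∫ g(x) St(x;μ,Σ,ν) dx`. -/
theorem sstsrcr_unbiased (n : ℕ) (hn : 1 ≤ n) (ν : ℝ) (hν : 2 < ν)
    (μ : Fin n → ℝ) (A : Matrix (Fin n) (Fin n) ℝ) (hA : IsUnit A.det)
    (Sig : Matrix (Fin n) (Fin n) ℝ) (hSig : Sig = A * Aᵀ)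
    (g : (Fin n → ℝ) → ℝ)
    (hg : Integrable (fun x : Fin n → ℝ => g x * StPDF n μ Sig ν x))
    (μH : Measure (Matrix.orthogonalGroup (Fin n) ℝ)) [IsProbabilityMeasure μH]
    [μH.IsMulLeftInvariant]
    (hint : Integrable (fun Qr : Matrix.orthogonalGroup (Fin n) ℝ × ℝ =>
        (1 - n / ((ν - 2) * Qr.2 ^ 2)) * g μ +
          (1 / (2 * (ν - 2) * Qr.2 ^ 2)) *
            ∑ i : Fin n,
              (g (μ - (Qr.2 * Real.sqrt ν) •
                  (A *ᵥ ((Qr.1 : Matrix (Fin n) (Fin n) ℝ) *ᵥ Pi.single i 1))) +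
               g (μ + (Qr.2 * Real.sqrt ν) •
                  (A *ᵥ ((Qr.1 : Matrix (Fin n) (Fin n) ℝ) *ᵥ Pi.single i 1)))))
      (μH.prod (radialLaw n ν))) :
    ∫ Qr : Matrix.orthogonalGroup (Fin n) ℝ × ℝ,
        ((1 - n / ((ν - 2) * Qr.2 ^ 2)) * g μ +
          (1 / (2 * (ν - 2) * Qr.2 ^ 2)) *
            ∑ i : Fin n,
              (g (μ - (Qr.2 * Real.sqrt ν) •
                  (A *ᵥ ((Qr.1 : Matrix (Fin n) (Fin n) ℝ) *ᵥ Pi.single i 1))) +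
               g (μ + (Qr.2 * Real.sqrt ν) •
                  (A *ᵥ ((Qr.1 : Matrix (Fin n) (Fin n) ℝ) *ᵥ Pi.single i 1)))))
        ∂(μH.prod (radialLaw n ν)) =
      ∫ x : Fin n → ℝ, g x * StPDF n μ Sig ν x := by
  subst hSig
  have hν0 : 0 < ν := by linarith
  have hν2 : 0 < ν - 2 := by linarith
  have hn0 : (0 : ℝ) < n := by exact_mod_cast hn
  have hdet : A.det ≠ 0 := hA.ne_zero
  set B := Beta (((n : ℝ) + 2) / 2) ((ν - 2) / 2) with hB
  have hBpos : 0 < B := by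
    have h1 := Real.Gamma_pos_of_pos (show 0 < (ν - 2) / 2 by positivity)
    have h2 := Real.Gamma_pos_of_pos (show 0 < ((n : ℝ) + 2) / 2 by positivity)
    have h3 := Real.Gamma_pos_of_pos (show 0 < ((n : ℝ) + 2) / 2 + (ν - 2) / 2 by positivity)
    rw [hB, Beta]
    positivity
  set K := (Real.Gamma ((ν + n) / 2) / Real.Gamma (ν / 2)) * (ν * Real.pi) ^ (-(n : ℝ) / 2) *
        (A * Aᵀ).det ^ (-(1 : ℝ) / 2) with hK
  have hnorm : 2 * n * (B * (ν - 2))⁻¹ * (unitSphereArea n * (√ν ^ n * |A.det|))⁻¹ = K :=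
    normalization_identity hn hν hdet (by rw [det_mul, det_transpose])
  have hKpos : 0 < K := by
    rw [← hnorm]
    have := unitSphereArea_pos hn
    have := Real.sqrt_pos.2 hν0
    positivity
  set f : (Fin n → ℝ) → ℝ := fun x => g x * StPDF n μ (A * Aᵀ) ν x with hf
  have hsν : √ν ≠ 0 := (Real.sqrt_pos.2 hν0).ne'
  have hplus := fun i : Fin n => integral_comp_affine_orthogonal i μ hsν hdet μH hg
  have hminus := fun i : Fin n => integral_comp_affine_orthogonal i μ (neg_ne_zero.2 hsν) hdet μH hg
  obtain ⟨hri, hr0⟩ := radial_moment_identity hn hν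
  have hmeas : Measurable fun r : ℝ => ENNReal.ofReal
      (2 * r ^ 2 * (1 + r ^ 2) ^ (-((ν + n) / 2)) / B) := by fun_prop
  rw [radialLaw_eq_withDensity hn, prod_withDensity_right hmeas,
    integral_withDensity_eq_integral_toReal_smul (by fun_prop) (by simp)]
  have hpt : ∀ᵐ p : Matrix.orthogonalGroup (Fin n) ℝ × ℝ ∂(μH.prod (polarRadialMeasure n)),
      0 < p.2 :=
    Measure.quasiMeasurePreserving_snd.ae (ae_pos_polarRadialMeasure n)
  rw [integral_congr_ae (g := fun p : Matrix.orthogonalGroup (Fin n) ℝ × ℝ =>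
      2 / B * g μ * ((p.2 ^ 2 - n / (ν - 2)) * (1 + p.2 ^ 2) ^ (-((ν + n) / 2))) +
      (B * (ν - 2))⁻¹ * K⁻¹ * ∑ i : Fin n,
        (f (μ + (p.2 * -√ν) • (A *ᵥ ((p.1 : Matrix (Fin n) (Fin n) ℝ) *ᵥ Pi.single i 1))) +
         f (μ + (p.2 * √ν) • (A *ᵥ ((p.1 : Matrix (Fin n) (Fin n) ℝ) *ᵥ Pi.single i 1)))))]
  · have hsum : ∀ i ∈ (Finset.univ : Finset (Fin n)), Integrable
        (fun p : Matrix.orthogonalGroup (Fin n) ℝ × ℝ =>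
        (f (μ + (p.2 * -√ν) • (A *ᵥ ((p.1 : Matrix (Fin n) (Fin n) ℝ) *ᵥ Pi.single i 1))) +
         f (μ + (p.2 * √ν) • (A *ᵥ ((p.1 : Matrix (Fin n) (Fin n) ℝ) *ᵥ Pi.single i 1)))))
        (μH.prod (polarRadialMeasure n)) := fun i _ => (hminus i).1.add (hplus i).1
    rw [integral_add ((hri.comp_snd μH).const_mul _) ((integrable_finsetSum _ hsum).const_mul _),
      integral_const_mul, integral_const_mul, integral_finsetSum _ hsum,
      integral_fun_snd (fun r : ℝ => (r ^ 2 - n / (ν - 2)) * (1 + r ^ 2) ^ (-((ν + n) / 2))), hr0,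
      Finset.sum_congr rfl fun i _ => integral_add (hminus i).1 (hplus i).1]
    simp only [(hminus _).2, (hplus _).2, abs_neg, abs_of_pos (Real.sqrt_pos.2 hν0), smul_zero,
      mul_zero, zero_add, Finset.sum_const, Finset.card_univ, Fintype.card_fin, nsmul_eq_mul]
    have : (B * (ν - 2))⁻¹ * K⁻¹ * (n * ((unitSphereArea n * (√ν ^ n * |A.det|))⁻¹ * (∫ x, f x) +
        (unitSphereArea n * (√ν ^ n * |A.det|))⁻¹ * ∫ x, f x)) =
        (2 * n * (B * (ν - 2))⁻¹ * (unitSphereArea n * (√ν ^ n * |A.det|))⁻¹) * K⁻¹ *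
          ∫ x, f x := by ring
    rw [this, hnorm, mul_inv_cancel₀ hKpos.ne', one_mul]
  · filter_upwards [hpt] with p hp
    have hw : 0 ≤ 2 * p.2 ^ 2 * (1 + p.2 ^ 2) ^ (-((ν + n) / 2)) / B := by positivity
    simp only [hf, StPDF_affine_orthogonal _ hν0 μ hA (Real.sq_sqrt hν0.le),
      StPDF_affine_orthogonal _ hν0 μ hA ((neg_sq _).trans (Real.sq_sqrt hν0.le)), ← hK,
      ENNReal.toReal_ofReal hw, smul_eq_mul, ← add_mul, ← Finset.sum_mul]
    simp only [mul_neg, neg_smul, ← sub_eq_add_neg]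
    field_simp
end
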